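/- arXiv:1810.01654 — 6 statements merged into one kernel-verified Lean document; each statement's English description precedes it below -/
import Mathlib

section
/- Let L be an orthomodular σ-lattice and let f be a conditional state on L. Then there exists an s-map p on L that is σ-additive in both variables such that p(a,b) = f(a|b)·f(b|1) for every a ∈ L and every b ∈ L₀ = L \ {0}; concretely, the map p defined by p(a,b) = f(a|b)·f(b|1) for b ≠ 0 and p(a,0) = 0 is such an s-map. -/
/-- A σ-complete orthomodular lattice (σ-OML): a bounded lattice (with distinct
least element `⊥` and greatest element `⊤`) equipped with an orthocomplementation
`compl` satisfying the orthomodular law, in which every countable family of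
elements has a least upper bound. -/
class SigmaOML (L : Type) extends Lattice L, BoundedOrder L where
  compl : L → L
  compl_compl : ∀ a : L, compl (compl a) = a
  sup_compl : ∀ a : L, a ⊔ compl a = ⊤
  compl_antitone : ∀ a b : L, a ≤ b → compl b ≤ compl a
  orthomodular : ∀ a b : L, a ≤ b → b = a ⊔ compl a ⊓ b
  bot_ne_top : (⊥ : L) ≠ ⊤
  exists_countable_lub : ∀ f : ℕ → L, ∃ s : L, IsLUB (Set.range f) s

/-- `a` is orthogonal to `b` (`a ⊥ b`) if `a ≤ b'`. -/
def SigmaOML.Orthogonal {L : Type} [SigmaOML L] (a b : L) : Prop :=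
  a ≤ SigmaOML.compl b

/-- `a` and `b` are compatible (`a ↔ b`) if `a = (a ∧ b) ∨ (a ∧ b')` and
`b = (a ∧ b) ∨ (a' ∧ b)`. -/
def SigmaOML.Compatible {L : Type} [SigmaOML L] (a b : L) : Prop :=
  a = a ⊓ b ⊔ a ⊓ SigmaOML.compl b ∧ b = a ⊓ b ⊔ SigmaOML.compl a ⊓ b

/-- A σ-additive state on a σ-OML `L`: a map `m : L → [0,1]` with `m ⊤ = 1` which is
σ-additive on every at most countable family of pairwise orthogonal elements. -/
structure OMLState (L : Type) [SigmaOML L] where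
  toFun : L → ℝ
  nonneg : ∀ a, 0 ≤ toFun a
  le_one : ∀ a, toFun a ≤ 1
  map_top : toFun ⊤ = 1
  additive : ∀ {ι : Type} [Countable ι] (f : ι → L) (s : L),
    (∀ i j, i ≠ j → SigmaOML.Orthogonal (f i) (f j)) →
    IsLUB (Set.range f) s →
    HasSum (fun i => toFun (f i)) (toFun s)

/-- An s-map on a σ-OML `L`: a map `p : L × L → [0,1]` with `p(⊤,⊤) = 1`, vanishing on
orthogonal pairs, and σ-additive in each variable on at most countable families of
pairwise orthogonal elements. -/
structure OMLSMap (L : Type) [SigmaOML L] where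
  toFun : L → L → ℝ
  nonneg : ∀ a b, 0 ≤ toFun a b
  le_one : ∀ a b, toFun a b ≤ 1
  map_top_top : toFun ⊤ ⊤ = 1
  orthogonal_eq_zero : ∀ a b, SigmaOML.Orthogonal a b → toFun a b = 0
  additive_left : ∀ {ι : Type} [Countable ι] (f : ι → L) (s b : L),
    (∀ i j, i ≠ j → SigmaOML.Orthogonal (f i) (f j)) →
    IsLUB (Set.range f) s →
    HasSum (fun i => toFun (f i) b) (toFun s b)
  additive_right : ∀ {ι : Type} [Countable ι] (f : ι → L) (s b : L),
    (∀ i j, i ≠ j → SigmaOML.Orthogonal (f i) (f j)) →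
    IsLUB (Set.range f) s →
    HasSum (fun i => toFun b (f i)) (toFun b s)

/-- A conditional state on a σ-OML `L`: a map `f : L × L₀ → [0,1]` (here `L₀ = L \ {⊥}`,
encoded by the hypothesis `b ≠ ⊥`) such that
(c1) `f(·|b)` is a σ-additive state for every `b ∈ L₀`;
(c2) `f(a|a) = 1` for every `a ∈ L₀`;
(c3) for every at most countable (nonempty) family of pairwise orthogonal elements of `L₀`
with least upper bound `s` and every `b`, `f(b|s) = Σᵢ f(b|aᵢ)·f(aᵢ|s)`. -/
structure OMLConditionalState (L : Type) [SigmaOML L] where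
  toFun : L → L → ℝ   -- `toFun a b` stands for `f(a|b)`
  nonneg : ∀ a b : L, b ≠ ⊥ → 0 ≤ toFun a b
  le_one : ∀ a b : L, b ≠ ⊥ → toFun a b ≤ 1
  map_top : ∀ b : L, b ≠ ⊥ → toFun ⊤ b = 1
  additive : ∀ (b : L), b ≠ ⊥ → ∀ {ι : Type} [Countable ι] (g : ι → L) (s : L),
    (∀ i j, i ≠ j → SigmaOML.Orthogonal (g i) (g j)) →
    IsLUB (Set.range g) s →
    HasSum (fun i => toFun (g i) b) (toFun s b)
  diag : ∀ a : L, a ≠ ⊥ → toFun a a = 1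
  cond_additive : ∀ {ι : Type} [Countable ι] [Nonempty ι] (g : ι → L) (s b : L),
    (∀ i, g i ≠ ⊥) →
    (∀ i j, i ≠ j → SigmaOML.Orthogonal (g i) (g j)) →
    IsLUB (Set.range g) s →
    HasSum (fun i => toFun b (g i) * toFun (g i) s) (toFun b s)

namespace SigmaOML

variable {L : Type} [SigmaOML L]

theorem Orthogonal.symm {a b : L} (h : Orthogonal a b) : Orthogonal b a := by
  have h' := compl_antitone _ _ h
  rwa [compl_compl] at h'

theorem pairwise_orthogonal_bool {a b : L} (h : Orthogonal a b) (i j : Bool) (hij : i ≠ j) :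
    Orthogonal (cond i a b) (cond j a b) := by
  cases i <;> cases j
  · exact absurd rfl hij
  · exact h.symm
  · exact h
  · exact absurd rfl hij

theorem isLUB_range_bool (a b : L) :
    IsLUB (Set.range fun i : Bool => cond i a b) (a ⊔ b) := by
  have h : (Set.range fun i : Bool => cond i a b) = {a, b} := by
    ext x
    simp [or_comm, eq_comm]
  rw [h]
  exact isLUB_pair

theorem orthogonal_compl_of_le {a b : L} (h : a ≤ b) : Orthogonal a (compl b) := by
  rwa [Orthogonal, compl_compl]

end SigmaOML

namespace OMLConditionalState

open SigmaOML

variable {L : Type} [SigmaOML L] (f : OMLConditionalState L)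

theorem eq_zero_of_orthogonal {a b : L} (hb : b ≠ ⊥) (h : Orthogonal a b) :
    f.toFun a b = 0 := by
  have hs := f.additive b hb _ _ (pairwise_orthogonal_bool h) (isLUB_range_bool a b)
  have hsum := hs.unique (hasSum_fintype _)
  simp only [Fintype.sum_bool, cond_true, cond_false, f.diag b hb] at hsum
  linarith [f.le_one (a ⊔ b) b hb, f.nonneg a b hb]

theorem mul_top_of_le {a s : L} (hs : s ≠ ⊥) (h : a ≤ s) :
    f.toFun a s * f.toFun s ⊤ = f.toFun a ⊤ := by
  by_cases hc : compl s = ⊥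
  · have hst : s = ⊤ := by
      simpa [hc] using sup_compl s
    subst hst
    rw [f.diag ⊤ hs, mul_one]
  · have hlub := isLUB_range_bool s (compl s)
    rw [sup_compl] at hlub
    have hsum := (f.cond_additive _ _ a (fun i => by cases i <;> simpa)
      (pairwise_orthogonal_bool (orthogonal_compl_of_le le_rfl)) hlub).unique (hasSum_fintype _)
    simp only [Fintype.sum_bool, cond_true, cond_false,
      f.eq_zero_of_orthogonal hc (orthogonal_compl_of_le h)] at hsum
    linarith

open Classical in
/-- The map `(a, b) ↦ f(a|b) · f(b|⊤)`, extended by `0` at `b = ⊥`. -/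
noncomputable def joint (a b : L) : ℝ :=
  if b = ⊥ then 0 else f.toFun a b * f.toFun b ⊤

@[simp]
theorem joint_bot (a : L) : f.joint a ⊥ = 0 := if_pos rfl

theorem joint_of_ne_bot (a : L) {b : L} (hb : b ≠ ⊥) :
    f.joint a b = f.toFun a b * f.toFun b ⊤ := if_neg hb

theorem hasSum_joint_left {ι : Type} [Countable ι] (g : ι → L) (s b : L)
    (hg : ∀ i j, i ≠ j → Orthogonal (g i) (g j)) (hs : IsLUB (Set.range g) s) :
    HasSum (fun i => f.joint (g i) b) (f.joint s b) := by
  by_cases hb : b = ⊥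
  · subst hb
    simp [hasSum_zero]
  · simp only [f.joint_of_ne_bot _ hb]
    exact (f.additive b hb g s hg hs).mul_right _

theorem hasSum_joint_right {ι : Type} [Countable ι] (g : ι → L) (s b : L)
    (hg : ∀ i j, i ≠ j → Orthogonal (g i) (g j)) (hs : IsLUB (Set.range g) s) :
    HasSum (fun i => f.joint b (g i)) (f.joint b s) := by
  have hle : ∀ i, g i ≤ s := fun i => hs.1 ⟨i, rfl⟩
  by_cases hbot : ∀ i, g i = ⊥
  · have hs' : s = ⊥ := le_bot_iff.1 (hs.2 (by rintro _ ⟨i, rfl⟩; exact (hbot i).le))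
    simp [hbot, hs', hasSum_zero]
  push Not at hbot
  obtain ⟨i₀, hi₀⟩ := hbot
  have hs0 : s ≠ ⊥ := fun h => hi₀ (le_bot_iff.1 (h ▸ hle i₀))
  have : Nonempty {i | g i ≠ ⊥} := ⟨⟨i₀, hi₀⟩⟩
  have hlub : IsLUB (Set.range fun i : {i | g i ≠ ⊥} => g i) s := by
    refine ⟨by rintro _ ⟨i, rfl⟩; exact hle i, fun u hu => hs.2 ?_⟩
    rintro _ ⟨i, rfl⟩
    by_cases hi : g i = ⊥
    · exact hi.le.trans bot_le
    · exact hu ⟨⟨i, hi⟩, rfl⟩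
  have hsum := (f.cond_additive (fun i : {i | g i ≠ ⊥} => g i) s b (fun i => i.2)
    (fun i j hij => hg i j fun h => hij (Subtype.ext h)) hlub).mul_right (f.toFun s ⊤)
  have hsupp : (Function.support fun i => f.joint b (g i)) ⊆ {i | g i ≠ ⊥} := by
    intro i hi h
    exact hi (by simp [h])
  rw [← hasSum_subtype_iff_of_support_subset hsupp, f.joint_of_ne_bot b hs0]
  have heq : (fun i => f.joint b (g i)) ∘ ((↑) : {i | g i ≠ ⊥} → ι) =
      fun i : {i | g i ≠ ⊥} => f.toFun b (g i) * f.toFun (g i) s * f.toFun s ⊤ := by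
    funext i
    rw [Function.comp_apply, f.joint_of_ne_bot b i.2, mul_assoc, f.mul_top_of_le hs0 (hle i)]
  rw [heq]
  exact hsum

end OMLConditionalState

/-- For every conditional state `f` on a σ-OML `L` there is an s-map `p`
(σ-additive in both variables) with `p(a,b) = f(a|b)·f(b|1)` for all `a ∈ L`, `b ∈ L₀`;
concretely the map defined by `p(a,b) = f(a|b)·f(b|1)` for `b ≠ 0` and `p(a,0) = 0`
is such an s-map. -/
theorem exists_sMap_of_conditionalState {L : Type} [SigmaOML L]
    (f : OMLConditionalState L) :
    ∃ p : OMLSMap L,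
      (∀ a b : L, b ≠ ⊥ → p.toFun a b = f.toFun a b * f.toFun b ⊤) ∧
      (∀ a : L, p.toFun a ⊥ = 0) := by
  have htop : (⊤ : L) ≠ ⊥ := SigmaOML.bot_ne_top.symm
  refine ⟨⟨f.joint, fun a b => ?_, fun a b => ?_, ?_, fun a b hab => ?_,
    f.hasSum_joint_left, f.hasSum_joint_right⟩,
    fun a b hb => f.joint_of_ne_bot a hb, f.joint_bot⟩
  · by_cases hb : b = ⊥
    · simp [hb]
    · rw [f.joint_of_ne_bot a hb]
      exact mul_nonneg (f.nonneg a b hb) (f.nonneg b ⊤ htop)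
  · by_cases hb : b = ⊥
    · simp [hb]
    · rw [f.joint_of_ne_bot a hb]
      exact mul_le_one₀ (f.le_one a b hb) (f.nonneg b ⊤ htop) (f.le_one b ⊤ htop)
  · rw [f.joint_of_ne_bot ⊤ htop, f.diag ⊤ htop, mul_one]
  · by_cases hb : b = ⊥
    · simp [hb]
    · rw [f.joint_of_ne_bot a hb, f.eq_zero_of_orthogonal hb hab, zero_mul]
end

section
/- Let L be an orthomodular σ-lattice and let p be an s-map on L that is σ-additive in both variables. Then the map μ_p : L → [0,1] defined by μ_p(a) = p(a,a) is a σ-additive state on L. -/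
/-- If `s` is the supremum of a countable orthogonal family `f`, then `p(fᵢ, s) = p(fᵢ, fᵢ)`. -/
theorem OMLSMap.apply_lub {L : Type} [SigmaOML L] (p : OMLSMap L) {ι : Type} [Countable ι]
    (f : ι → L) (s : L) (hf : ∀ i j, i ≠ j → SigmaOML.Orthogonal (f i) (f j))
    (hs : IsLUB (Set.range f) s) (i : ι) : p.toFun (f i) s = p.toFun (f i) (f i) :=
  (p.additive_right f s (f i) hf hs).unique
    (hasSum_single i fun j hj => p.orthogonal_eq_zero _ _ (hf i j hj.symm))

/-- For every s-map `p` on a σ-OML `L` (σ-additive in both variables),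
the map `μ_p : a ↦ p(a,a)` is a σ-additive state on `L`. -/
theorem mu_of_sMap_is_state {L : Type} [SigmaOML L] (p : OMLSMap L) :
    ∃ m : OMLState L, ∀ a : L, m.toFun a = p.toFun a a :=
  ⟨{ toFun := fun a => p.toFun a a
     nonneg := fun a => p.nonneg a a
     le_one := fun a => p.le_one a a
     map_top := p.map_top_top
     additive := fun f s hf hs => by
      simpa only [p.apply_lub f s hf hs] using p.additive_left f s s hf hs }, fun _ => rfl⟩
end

section
/- Let L be an orthomodular σ-lattice, let p be an s-map on L, and let a, b ∈ L with μ_p(a) = p(a,a) ≠ 0. Then p(b,1)/p(1,1) = p(b,a)/p(a,a) if and only if p(b,a) = p(b,b)·p(a,a). (In the terminology of conditional states induced by p, f_p(b|1) = f_p(b|a) if and only if p(b,a) = p(b,b)·p(a,a), where f_p(x|y) = p(x,y)/p(y,y) whenever p(y,y) ≠ 0.) -/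
/-- The diagonal of an s-map is its second marginal at `⊤`: `p(b,1) = p(b,b)`. -/
theorem OMLSMap.apply_top_right {L : Type} [SigmaOML L] (p : OMLSMap L) (b : L) :
    p.toFun b ⊤ = p.toFun b b := by
  have hb : SigmaOML.Orthogonal b (SigmaOML.compl b) :=
    (SigmaOML.compl_compl b).ge
  have hlub : IsLUB (Set.range fun i : Bool => cond i b (SigmaOML.compl b)) ⊤ := by
    have hrange : (Set.range fun i : Bool => cond i b (SigmaOML.compl b)) =
        {b, SigmaOML.compl b} := by
      ext x
      simp [eq_comm, or_comm]
    rw [hrange, ← SigmaOML.sup_compl b]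
    exact isLUB_pair
  have hsum := p.additive_right (fun i : Bool => cond i b (SigmaOML.compl b)) ⊤ b (by
    rintro (_ | _) (_ | _) hij
    · exact absurd rfl hij
    · exact le_refl (SigmaOML.compl b)
    · exact hb
    · exact absurd rfl hij) hlub
  have h := hsum.unique (hasSum_fintype _)
  simpa [p.orthogonal_eq_zero b _ hb] using h

/-- For an s-map `p` on a σ-OML `L` and `a, b ∈ L` with `μ_p(a) = p(a,a) ≠ 0`:
`p(b,1)/p(1,1) = p(b,a)/p(a,a)` if and only if `p(b,a) = p(b,b)·p(a,a)`
(i.e. `f_p(b|1) = f_p(b|a)` iff `p(b,a) = p(b,b)·p(a,a)`). -/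
theorem sMap_independence_iff {L : Type} [SigmaOML L] (p : OMLSMap L) (a b : L)
    (ha : p.toFun a a ≠ 0) :
    p.toFun b ⊤ / p.toFun ⊤ ⊤ = p.toFun b a / p.toFun a a ↔
      p.toFun b a = p.toFun b b * p.toFun a a := by
  rw [p.map_top_top, p.apply_top_right, div_one, eq_div_iff ha, eq_comm]
end

section
/- Let L be an orthomodular σ-lattice and let p be an s-map on L. If a, b ∈ L satisfy μ_p(a) = μ_p(b) = 1, then p(a,b) = p(b,a) = 1, and moreover p(a,c) = p(c,a) for all c ∈ L (the Jauch–Piron property of s-maps). -/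
namespace SigmaOML

variable {L : Type} [SigmaOML L]

theorem isLUB_pair_compl (a : L) :
    IsLUB (Set.range fun i : Bool => if i then a else compl a) ⊤ := by
  refine ⟨fun _ _ => le_top, fun s hs => ?_⟩
  rw [← sup_compl a]
  exact sup_le (hs ⟨true, rfl⟩) (hs ⟨false, rfl⟩)

theorem orthogonal_compl_self (a : L) : Orthogonal a (compl a) :=
  (compl_compl a).ge

theorem compl_self_orthogonal (a : L) : Orthogonal (compl a) a :=
  le_refl (compl a)

theorem pairwise_orthogonal_pair_compl (a : L) (i j : Bool) (hij : i ≠ j) :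
    Orthogonal (if i then a else compl a) (if j then a else compl a) := by
  cases i <;> cases j
  · exact absurd rfl hij
  · exact compl_self_orthogonal a
  · exact orthogonal_compl_self a
  · exact absurd rfl hij

end SigmaOML

namespace OMLSMap

variable {L : Type} [SigmaOML L] (p : OMLSMap L)

theorem add_compl_left (a b : L) :
    p.toFun a b + p.toFun (SigmaOML.compl a) b = p.toFun ⊤ b := by
  have h := p.additive_left _ _ b (SigmaOML.pairwise_orthogonal_pair_compl a)
    (SigmaOML.isLUB_pair_compl a)
  simpa using (hasSum_fintype _).unique h

theorem add_compl_right (a b : L) :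
    p.toFun b a + p.toFun b (SigmaOML.compl a) = p.toFun b ⊤ := by
  have h := p.additive_right _ _ b (SigmaOML.pairwise_orthogonal_pair_compl a)
    (SigmaOML.isLUB_pair_compl a)
  simpa using (hasSum_fintype _).unique h

theorem top_left (a : L) : p.toFun ⊤ a = p.toFun a a := by
  rw [← p.add_compl_left a a,
    p.orthogonal_eq_zero _ _ (SigmaOML.compl_self_orthogonal a), add_zero]

theorem top_right (a : L) : p.toFun a ⊤ = p.toFun a a := by
  rw [← p.add_compl_right a a,
    p.orthogonal_eq_zero _ _ (SigmaOML.orthogonal_compl_self a), add_zero]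

theorem compl_self_eq_zero {a : L} (ha : p.toFun a a = 1) :
    p.toFun (SigmaOML.compl a) (SigmaOML.compl a) = 0 := by
  have h := p.add_compl_left a ⊤
  rw [p.top_right, p.top_right, p.map_top_top] at h
  linarith

theorem eq_self_of_left_eq_one {a : L} (ha : p.toFun a a = 1) (c : L) :
    p.toFun a c = p.toFun c c := by
  have h₁ := p.add_compl_left a c
  have h₂ := p.add_compl_right c (SigmaOML.compl a)
  rw [p.top_left] at h₁
  rw [p.top_right, p.compl_self_eq_zero ha] at h₂
  linarith [p.nonneg (SigmaOML.compl a) c,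
    p.nonneg (SigmaOML.compl a) (SigmaOML.compl c)]

theorem eq_self_of_right_eq_one {a : L} (ha : p.toFun a a = 1) (c : L) :
    p.toFun c a = p.toFun c c := by
  have h₁ := p.add_compl_right a c
  have h₂ := p.add_compl_left c (SigmaOML.compl a)
  rw [p.top_right] at h₁
  rw [p.top_left, p.compl_self_eq_zero ha] at h₂
  linarith [p.nonneg c (SigmaOML.compl a),
    p.nonneg (SigmaOML.compl c) (SigmaOML.compl a)]

end OMLSMap

/-- Jauch–Piron property: If `p` is an s-map on a σ-OML `L` and
`μ_p(a) = μ_p(b) = 1`, then `p(a,b) = p(b,a) = 1`, and `p(a,c) = p(c,a)` for all `c`. -/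
theorem sMap_jauch_piron {L : Type} [SigmaOML L] (p : OMLSMap L) (a b : L)
    (ha : p.toFun a a = 1) (hb : p.toFun b b = 1) :
    p.toFun a b = 1 ∧ p.toFun b a = 1 ∧ ∀ c : L, p.toFun a c = p.toFun c a := by
  refine ⟨?_, ?_, fun c => ?_⟩
  · rw [p.eq_self_of_left_eq_one ha, hb]
  · rw [p.eq_self_of_right_eq_one ha, hb]
  · rw [p.eq_self_of_left_eq_one ha, p.eq_self_of_right_eq_one ha]
end

section
/- Let L be an orthomodular σ-lattice in which every two elements are compatible (in particular, let L be a Boolean σ-algebra). Then every s-map p on L is symmetric: p(a,b) = p(b,a) = μ_p(a ∧ b) for all a, b ∈ L. Hence no causal s-map exists on a Boolean σ-algebra. -/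
namespace SigmaOML

variable {L : Type} [SigmaOML L]

theorem orthogonal_of_le_of_le_compl {a b c : L} (ha : a ≤ c) (hb : b ≤ compl c) :
    Orthogonal a b :=
  Orthogonal.symm (hb.trans (compl_antitone _ _ ha))

theorem Orthogonal.pairwise_cond {x y : L} (h : Orthogonal x y) (i j : Bool) (hij : i ≠ j) :
    Orthogonal (cond i x y) (cond j x y) := by
  cases i <;> cases j
  · exact absurd rfl hij
  · exact h.symm
  · exact h
  · exact absurd rfl hij

theorem isLUB_range_cond (x y : L) :
    IsLUB (Set.range fun i : Bool => cond i x y) (x ⊔ y) := by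
  have : Set.range (fun i : Bool => cond i x y) = {x, y} := by
    ext z
    simp [or_comm, eq_comm]
  rw [this]
  exact isLUB_pair

end SigmaOML

namespace OMLSMap

open SigmaOML

variable {L : Type} [SigmaOML L] (p : OMLSMap L)

theorem map_sup_left {x y : L} (h : Orthogonal x y) (b : L) :
    p.toFun (x ⊔ y) b = p.toFun x b + p.toFun y b := by
  have := p.additive_left _ _ b h.pairwise_cond (isLUB_range_cond x y)
  simpa using this.unique (hasSum_fintype _)

theorem map_sup_right {x y : L} (h : Orthogonal x y) (b : L) :
    p.toFun b (x ⊔ y) = p.toFun b x + p.toFun b y := by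
  have := p.additive_right _ _ b h.pairwise_cond (isLUB_range_cond x y)
  simpa using this.unique (hasSum_fintype _)

theorem eq_inf_of_compatible {a b : L} (h : Compatible a b) :
    p.toFun a b = p.toFun (a ⊓ b) (a ⊓ b) := by
  have hl : p.toFun a b = p.toFun (a ⊓ b) b := by
    conv_lhs => rw [h.1]
    rw [p.map_sup_left (orthogonal_of_le_of_le_compl inf_le_right inf_le_right),
      p.orthogonal_eq_zero (a ⊓ compl b) b inf_le_right, add_zero]
  have ho : Orthogonal (a ⊓ b) (compl a ⊓ b) :=
    orthogonal_of_le_of_le_compl inf_le_left inf_le_left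
  have hr : p.toFun (a ⊓ b) b = p.toFun (a ⊓ b) (a ⊓ b) := by
    conv_lhs => rw [congrArg (p.toFun (a ⊓ b)) h.2]
    rw [p.map_sup_right ho, p.orthogonal_eq_zero _ _ ho, add_zero]
  exact hl.trans hr

end OMLSMap

/-- If every two elements of a σ-OML `L` are compatible (in particular if
`L` is a Boolean σ-algebra), then every s-map `p` on `L` is symmetric, with
`p(a,b) = p(b,a) = μ_p(a ∧ b)`; hence no causal s-map exists on `L`. -/
theorem no_causal_sMap_on_boolean {L : Type} [SigmaOML L]
    (hcomp : ∀ a b : L, SigmaOML.Compatible a b) :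
    (∀ (p : OMLSMap L) (a b : L),
      p.toFun a b = p.toFun b a ∧ p.toFun a b = p.toFun (a ⊓ b) (a ⊓ b)) ∧
    ¬ ∃ (p : OMLSMap L) (a b : L), p.toFun a b ≠ p.toFun b a := by
  have key : ∀ (p : OMLSMap L) (a b : L), p.toFun a b = p.toFun b a := fun p a b => by
    rw [p.eq_inf_of_compatible (hcomp a b), p.eq_inf_of_compatible (hcomp b a), inf_comm]
  exact ⟨fun p a b => ⟨key p a b, p.eq_inf_of_compatible (hcomp a b)⟩,
    fun ⟨p, a, b, h⟩ => h (key p a b)⟩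
end

section
/- There exist an orthomodular σ-lattice L, an s-map p on L, and elements a, b ∈ L such that p(a,b) ≠ p(b,a), p(b,a) = μ_p(b)·μ_p(a), and p(a,b) ≠ μ_p(a)·μ_p(b); that is, there exists a strongly causal s-map (b is independent of a while a is dependent on b). Moreover, L can be taken to be the six-element horizontal sum of two four-element Boolean algebras, with atoms a, a', b, b', and p given by p(a,b) = 0.2, p(b,a) = 0.15, μ_p(a) = 0.3, μ_p(b) = 0.5. -/
/-- The property asserted of the witness in STATEMENT 10: `p(a,b) ≠ p(b,a)`,
`p(b,a) = μ_p(b)·μ_p(a)` while `p(a,b) ≠ μ_p(a)·μ_p(b)` (so `p` is strongly causal: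
`b` is independent of `a` while `a` is dependent on `b`), with the concrete values
`p(a,b) = 0.2`, `p(b,a) = 0.15`, `μ_p(a) = 0.3`, `μ_p(b) = 0.5`, and `L` is the
six-element horizontal sum `{0, a, a', b, b', 1}` of two four-element Boolean algebras. -/
def StronglyCausalWitness (L : Type) [SigmaOML L] (p : OMLSMap L) (a b : L) : Prop :=
  p.toFun a b ≠ p.toFun b a ∧
  p.toFun b a = p.toFun b b * p.toFun a a ∧
  p.toFun a b ≠ p.toFun a a * p.toFun b b ∧
  p.toFun a b = 0.2 ∧ p.toFun b a = 0.15 ∧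
  p.toFun a a = 0.3 ∧ p.toFun b b = 0.5 ∧
  (Set.univ : Set L) = {⊥, a, SigmaOML.compl a, b, SigmaOML.compl b, ⊤} ∧
  Nat.card L = 6

namespace SigmaOML

variable {L : Type} [SigmaOML L]

theorem compl_top : compl (⊤ : L) = ⊥ := by
  have := compl_antitone (compl ⊥) (⊤ : L) le_top
  rwa [compl_compl, le_bot_iff] at this

theorem Orthogonal.eq_bot_of_self {a : L} (h : Orthogonal a a) : a = ⊥ := by
  have h_top : compl a = ⊤ := by rw [← sup_compl a, sup_eq_right.mpr h]
  rw [← compl_compl a, h_top, compl_top]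

theorem Orthogonal.finset_sup {ι : Type} {f : ι → L} {a : L} {S : Finset ι}
    (h : ∀ i ∈ S, Orthogonal a (f i)) : Orthogonal a (S.sup f) :=
  Orthogonal.symm (Finset.sup_le fun i hi => (h i hi).symm)

theorem map_finset_sup_of_orthogonal {m : L → ℝ} (m_bot : m ⊥ = 0)
    (m_sup : ∀ a b, Orthogonal a b → m (a ⊔ b) = m a + m b) {ι : Type} (f : ι → L)
    (hf : ∀ i j, i ≠ j → Orthogonal (f i) (f j)) (S : Finset ι) :
    m (S.sup f) = ∑ i ∈ S, m (f i) := by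
  classical
  induction S using Finset.induction_on with
  | empty => simpa using m_bot
  | insert i S hi ih =>
    rw [Finset.sup_insert, Finset.sum_insert hi, m_sup, ih]
    exact Orthogonal.finset_sup fun j hj => hf i j (by rintro rfl; exact hi hj)

/-- On a finite orthomodular lattice, finite additivity on orthogonal pairs implies
additivity on arbitrary orthogonal families. -/
theorem hasSum_of_orthogonal [Finite L] {m : L → ℝ} (m_bot : m ⊥ = 0)
    (m_sup : ∀ a b, Orthogonal a b → m (a ⊔ b) = m a + m b) {ι : Type} (f : ι → L) (s : L)
    (hf : ∀ i j, i ≠ j → Orthogonal (f i) (f j)) (hs : IsLUB (Set.range f) s) :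
    HasSum (fun i => m (f i)) (m s) := by
  classical
  have h_fin : {i | f i ≠ ⊥}.Finite := by
    refine Set.Finite.of_finite_image (f := f) (Set.toFinite _) fun i hi j _ hij => ?_
    by_contra hne
    have h := hf i j hne
    rw [← hij] at h
    exact hi h.eq_bot_of_self
  have h_sup : s = h_fin.toFinset.sup f := by
    refine hs.unique ⟨?_, fun u hu => Finset.sup_le fun i _ => hu ⟨i, rfl⟩⟩
    rintro _ ⟨i, rfl⟩
    by_cases hi : f i = ⊥
    · simp [hi]
    · exact Finset.le_sup (f := f) (by simpa using hi)
  rw [h_sup, map_finset_sup_of_orthogonal m_bot m_sup f hf]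
  refine hasSum_sum_of_ne_finset_zero fun i hi => ?_
  have hi : f i = ⊥ := by simpa using hi
  rw [hi, m_bot]

end SigmaOML

/-- The horizontal sum of two four-element Boolean algebras. -/
inductive HorizontalSum : Type
  | bot | a | ac | b | bc | top
  deriving DecidableEq

namespace HorizontalSum

instance : Fintype HorizontalSum where
  elems := {bot, a, ac, b, bc, top}
  complete x := by cases x <;> decide

/-- The orthocomplementation of the horizontal sum. -/
def compl : HorizontalSum → HorizontalSum
  | bot => top
  | a => ac
  | ac => a
  | b => bc
  | bc => b
  | top => bot

instance : LE HorizontalSum := ⟨fun x y => x = bot ∨ y = top ∨ x = y⟩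

instance : DecidableRel (fun x y : HorizontalSum => x ≤ y) :=
  fun x y => inferInstanceAs (Decidable (x = bot ∨ y = top ∨ x = y))

/-- The join of two elements of the horizontal sum. -/
def join (x y : HorizontalSum) : HorizontalSum :=
  if x ≤ y then y else if y ≤ x then x else top

/-- The meet of two elements of the horizontal sum. -/
def meet (x y : HorizontalSum) : HorizontalSum :=
  if x ≤ y then x else if y ≤ x then y else bot

instance : Lattice HorizontalSum where
  le_refl := by decide
  le_trans := by decide
  le_antisymm := by decide
  sup := join
  inf := meet
  le_sup_left := by decide
  le_sup_right := by decide
  sup_le := by decide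
  inf_le_left := by decide
  inf_le_right := by decide
  le_inf := by decide

instance : BoundedOrder HorizontalSum where
  top := top
  bot := bot
  le_top := by decide
  bot_le := by decide

instance : SigmaOML HorizontalSum where
  compl := compl
  compl_compl := by decide
  sup_compl := by decide
  compl_antitone := by decide
  orthomodular := by decide
  bot_ne_top := by decide
  exists_countable_lub f := by
    classical
    refine ⟨(Set.toFinite (Set.range f)).toFinset.sup id, ?_⟩
    simpa using Finset.isLUB_sup_id (s := (Set.toFinite (Set.range f)).toFinset)

instance : DecidableRel (SigmaOML.Orthogonal (L := HorizontalSum)) :=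
  fun x y => inferInstanceAs (Decidable (x ≤ compl y))

/-- Twenty times the state `x ↦ p(x, x)`. -/
def stateWeight : HorizontalSum → ℕ
  | bot => 0
  | a => 6
  | ac => 14
  | b => 10
  | bc => 10
  | top => 20

/-- Twenty times the strongly causal s-map. -/
def weight : HorizontalSum → HorizontalSum → ℕ
  | bot, _ => 0
  | _, bot => 0
  | top, y => stateWeight y
  | x, top => stateWeight x
  | a, b => 4
  | a, bc => 2
  | ac, b => 6
  | ac, bc => 8
  | b, a => 3
  | b, ac => 7
  | bc, a => 3
  | bc, ac => 7
  | x, y => if x = y then stateWeight x else 0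

theorem weight_le (x y : HorizontalSum) : weight x y ≤ 20 := by
  revert x y; decide

theorem weight_orthogonal {x y : HorizontalSum} (h : SigmaOML.Orthogonal x y) :
    weight x y = 0 := by
  revert x y; decide

theorem weight_sup_left {x y : HorizontalSum} (h : SigmaOML.Orthogonal x y)
    (z : HorizontalSum) : weight (x ⊔ y) z = weight x z + weight y z := by
  revert x y z; decide

theorem weight_sup_right {x y : HorizontalSum} (h : SigmaOML.Orthogonal x y)
    (z : HorizontalSum) : weight z (x ⊔ y) = weight z x + weight z y := by
  revert x y z; decide

theorem weight_bot_left (z : HorizontalSum) : weight ⊥ z = 0 := by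
  revert z; decide

theorem weight_bot_right (z : HorizontalSum) : weight z ⊥ = 0 := by
  revert z; decide

/-- The strongly causal s-map on the horizontal sum. -/
noncomputable def sMap : OMLSMap HorizontalSum where
  toFun x y := (weight x y : ℝ) / 20
  nonneg x y := by positivity
  le_one x y := by
    have : (weight x y : ℝ) ≤ 20 := by exact_mod_cast weight_le x y
    linarith
  map_top_top := by
    have : weight ⊤ ⊤ = 20 := by decide
    norm_num [this]
  orthogonal_eq_zero x y h := by simp [weight_orthogonal h]
  additive_left f s z hf hs :=
    SigmaOML.hasSum_of_orthogonal (m := fun x => (weight x z : ℝ) / 20)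
      (by simp [weight_bot_left])
      (fun x y h => by simp only [weight_sup_left h]; push_cast; ring) f s hf hs
  additive_right f s z hf hs :=
    SigmaOML.hasSum_of_orthogonal (m := fun x => (weight z x : ℝ) / 20)
      (by simp [weight_bot_right])
      (fun x y h => by simp only [weight_sup_right h]; push_cast; ring) f s hf hs

end HorizontalSum

/-- There exist a σ-OML `L` (which can be taken to be the six-element
horizontal sum of two four-element Boolean algebras), an s-map `p` on `L` and elements
`a, b ∈ L` witnessing a strongly causal s-map. -/
theorem exists_strongly_causal_sMap :
    ∃ (L : Type) (inst : SigmaOML L) (p : @OMLSMap L inst) (a b : L),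
      @StronglyCausalWitness L inst p a b := by
  refine ⟨HorizontalSum, inferInstance, HorizontalSum.sMap, .a, .b, ?_⟩
  have h_univ : ∀ x : HorizontalSum, x = ⊥ ∨ x = .a ∨ x = SigmaOML.compl .a ∨ x = .b ∨
      x = SigmaOML.compl .b ∨ x = ⊤ := by decide
  refine ⟨?_, ?_, ?_, ?_, ?_, ?_, ?_, ?_, ?_⟩
  iterate 7
    norm_num [HorizontalSum.sMap, HorizontalSum.weight, HorizontalSum.stateWeight]
  · ext x
    simpa using h_univ x
  · rw [Nat.card_eq_fintype_card]
    decide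
end
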